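/- In U_q[gl(m|n)], for indices with c < a < d < b, the graded commutator satisfies [E^b_a, E^c_d] = Δ_a K_d^{-1} K_a E^c_a E^b_d. -/

import Mathlib

/-!
U_q[gl(m|n)]: the quantum superalgebra presented by generators and relations,
following Zhang (1993).  We work over the field ℚ(q) of rational functions.
-/

noncomputable section

/-- The base field ℚ(q) of rational functions in the indeterminate q. -/
abbrev Fq : Type := RatFunc ℚ

/-- The indeterminate q. -/
def qq : Fq := RatFunc.X

/-- The ℤ₂-grading of an index: `[a] = 0` if `a ≤ m`, `[a] = 1` if `a > m`. -/
def gr (m a : ℕ) : ℕ := if a ≤ m then 0 else 1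

/-- `q_a = q^{(-1)^{[a]}}`. -/
def qi (m a : ℕ) : Fq := if a ≤ m then qq else qq⁻¹

/-- `Δ = q - q⁻¹`. -/
def Δq : Fq := qq - qq⁻¹

/-- `Δ_a = (-1)^{[a]} Δ`. -/
def Δi (m a : ℕ) : Fq := (-1 : Fq) ^ gr m a * Δq

/-- Kronecker delta, as an integer. -/
def δℤ (a b : ℕ) : ℤ := if a = b then 1 else 0

/-- The sign `(-1)^{[E^a_b][E^c_d]}`, where `[E^a_b] = [a] + [b] (mod 2)`. -/
def sgn (m a b c d : ℕ) : Fq := (-1 : Fq) ^ ((gr m a + gr m b) * (gr m c + gr m d))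

/-- The quantum superalgebra `U_q[gl(m|n)]`: a unital associative ℚ(q)-algebra with
invertible Cartan generators `K a` (`1 ≤ a ≤ m+n`) and generators `E a b`
(simple ones for `|a-b| = 1`, nonsimple ones defined recursively for `|a-b| > 1`),
subject to the defining relations below. -/
structure UqGl (m n : ℕ) where
  /-- the underlying carrier -/
  A : Type
  ringA : Ring A
  algA : Algebra Fq A
  /-- Cartan generators `K_a` -/
  K : ℕ → A
  /-- inverse Cartan generators `K_a⁻¹` -/
  Kinv : ℕ → A
  /-- generators `E^a_b` -/
  E : ℕ → ℕ → A
  /-- (i) the Cartan generators commute -/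
  K_comm : ∀ a b, 1 ≤ a → a ≤ m + n → 1 ≤ b → b ≤ m + n →
    K a * K b = K b * K a
  /-- (i) `K_a K_a⁻¹ = 1` -/
  K_Kinv : ∀ a, 1 ≤ a → a ≤ m + n → K a * Kinv a = 1
  /-- (i) `K_a⁻¹ K_a = 1` -/
  Kinv_K : ∀ a, 1 ≤ a → a ≤ m + n → Kinv a * K a = 1
  /-- (ii) `K_a E^b_{b+1} = q_a^{δ^a_b - δ^a_{b+1}} E^b_{b+1} K_a` -/
  K_E_raise : ∀ a b, 1 ≤ a → a ≤ m + n → 1 ≤ b → b + 1 ≤ m + n →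
    K a * E b (b+1) = (qi m a ^ (δℤ a b - δℤ a (b+1))) • (E b (b+1) * K a)
  /-- (ii) `K_a E^{b+1}_b = q_a^{δ^a_{b+1} - δ^a_b} E^{b+1}_b K_a` -/
  K_E_lower : ∀ a b, 1 ≤ a → a ≤ m + n → 1 ≤ b → b + 1 ≤ m + n →
    K a * E (b+1) b = (qi m a ^ (δℤ a (b+1) - δℤ a b)) • (E (b+1) b * K a)
  /-- (iii) `[E^a_{a+1}, E^{b+1}_b] = δ^a_b Δ_a⁻¹ (K_a K_{a+1}⁻¹ - K_a⁻¹ K_{a+1})` -/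
  EF_rel : ∀ a b, 1 ≤ a → a + 1 ≤ m + n → 1 ≤ b → b + 1 ≤ m + n →
    E a (a+1) * E (b+1) b - sgn m a (a+1) (b+1) b • (E (b+1) b * E a (a+1)) =
      (if a = b then (Δi m a)⁻¹ else 0) • (K a * Kinv (a+1) - Kinv a * K (a+1))
  /-- (iv) simple lowering generators commute when `|a-b| > 1` -/
  EE_lower : ∀ a b, 1 ≤ a → a + 1 ≤ m + n → 1 ≤ b → b + 1 ≤ m + n →
    (a + 1 < b ∨ b + 1 < a) →
    E (a+1) a * E (b+1) b = E (b+1) b * E (a+1) a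
  /-- (iv) simple raising generators commute when `|a-b| > 1` -/
  EE_raise : ∀ a b, 1 ≤ a → a + 1 ≤ m + n → 1 ≤ b → b + 1 ≤ m + n →
    (a + 1 < b ∨ b + 1 < a) →
    E a (a+1) * E b (b+1) = E b (b+1) * E a (a+1)
  /-- (v) the square of the odd simple raising generator is zero -/
  odd_raise_sq : E m (m+1) * E m (m+1) = 0
  /-- (v) the square of the odd simple lowering generator is zero -/
  odd_lower_sq : E (m+1) m * E (m+1) m = 0
  /-- (vi) Serre relation `E^{a+1}_a E^{a+2}_a = q_a E^{a+2}_a E^{a+1}_a`, `a ≠ m` -/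
  serre1 : m ≠ 1 → n ≠ 1 → ∀ a, 1 ≤ a → a + 2 ≤ m + n → a ≠ m →
    E (a+1) a * E (a+2) a = qi m a • (E (a+2) a * E (a+1) a)
  /-- (vi) Serre relation `E^a_{a+1} E^a_{a+2} = q_a E^a_{a+2} E^a_{a+1}`, `a ≠ m` -/
  serre2 : m ≠ 1 → n ≠ 1 → ∀ a, 1 ≤ a → a + 2 ≤ m + n → a ≠ m →
    E a (a+1) * E a (a+2) = qi m a • (E a (a+2) * E a (a+1))
  /-- (vi) Serre relation `E^{a+1}_{a-1} E^{a+1}_a = q_a E^{a+1}_a E^{a+1}_{a-1}`, `a ≠ m` -/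
  serre3 : m ≠ 1 → n ≠ 1 → ∀ a, 2 ≤ a → a + 1 ≤ m + n → a ≠ m →
    E (a+1) (a-1) * E (a+1) a = qi m a • (E (a+1) a * E (a+1) (a-1))
  /-- (vi) Serre relation `E^{a-1}_{a+1} E^a_{a+1} = q_a E^a_{a+1} E^{a-1}_{a+1}`, `a ≠ m` -/
  serre4 : m ≠ 1 → n ≠ 1 → ∀ a, 2 ≤ a → a + 1 ≤ m + n → a ≠ m →
    E (a-1) (a+1) * E a (a+1) = qi m a • (E a (a+1) * E (a-1) (a+1))
  /-- (vi) Serre relation `[E^{m+1}_m, E^{m+2}_{m-1}] = 0` -/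
  serre5 : m ≠ 1 → n ≠ 1 →
    E (m+1) m * E (m+2) (m-1) -
      sgn m (m+1) m (m+2) (m-1) • (E (m+2) (m-1) * E (m+1) m) = 0
  /-- (vi) Serre relation `[E^m_{m+1}, E^{m-1}_{m+2}] = 0` -/
  serre6 : m ≠ 1 → n ≠ 1 →
    E m (m+1) * E (m-1) (m+2) -
      sgn m m (m+1) (m-1) (m+2) • (E (m-1) (m+2) * E m (m+1)) = 0
  /-- the nonsimple generators: for any `c` strictly between `a` and `b`,
  `E^a_b = E^a_c E^c_b - q_c^{sign(a-b)} E^c_b E^a_c` -/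
  nonsimple_def : ∀ a b c, 1 ≤ a → a ≤ m + n → 1 ≤ b → b ≤ m + n →
    ((a < c ∧ c < b) ∨ (b < c ∧ c < a)) →
    E a b = E a c * E c b - (if b < a then qi m c else (qi m c)⁻¹) • (E c b * E a c)

attribute [instance] UqGl.ringA UqGl.algA

namespace UqGl

variable {m n : ℕ}

/-- The graded commutator `[E^a_b, E^c_d] = E^a_b E^c_d - (-1)^{[E^a_b][E^c_d]} E^c_d E^a_b`. -/
def br (U : UqGl m n) (a b c d : ℕ) : U.A :=
  U.E a b * U.E c d - sgn m a b c d • (U.E c d * U.E a b)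

end UqGl

/-- Abstract computation behind the statement. -/
theorem aux_main {F A : Type} [Field F] [Ring A] [Algebra F A] (X Y Z W H H' : A)
    (p r s k : F) (hp : p ≠ 0) (hr : r ≠ 0)
    (hXZ : X * Z = Z * X) (hXW : X * W = W * X) (hYZ : Y * Z = Z * Y)
    (hYW : Y * W = s • (W * Y) + k • (H - H'))
    (hHZ : H * Z = p⁻¹ • (Z * H)) (hHX : H * X = r • (X * H))
    (hHZ' : H' * Z = p • (Z * H')) (hHX' : H' * X = r⁻¹ • (X * H')) :
    (X * Y - r • (Y * X)) * (Z * W - p⁻¹ • (W * Z))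
      - s • ((Z * W - p⁻¹ • (W * Z)) * (X * Y - r • (Y * X)))
      = (-k * (p - p⁻¹) * (r - r⁻¹)) • (H * Z * X) := by
  have e1 : ∀ t, X * (Z * t) = Z * (X * t) := fun t => by rw [← mul_assoc, hXZ, mul_assoc]
  have e2 : ∀ t, X * (W * t) = W * (X * t) := fun t => by rw [← mul_assoc, hXW, mul_assoc]
  have e3 : ∀ t, Y * (Z * t) = Z * (Y * t) := fun t => by rw [← mul_assoc, hYZ, mul_assoc]
  have e4 : ∀ t, Y * (W * t) = s • (W * (Y * t)) + k • (H * t - H' * t) := fun t => by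
    rw [← mul_assoc, hYW]; simp only [add_mul, sub_mul, smul_mul_assoc, mul_assoc]
  have e5 : ∀ t, H * (Z * t) = p⁻¹ • (Z * (H * t)) := fun t => by
    rw [← mul_assoc, hHZ, smul_mul_assoc, mul_assoc]
  have e6 : ∀ t, H * (X * t) = r • (X * (H * t)) := fun t => by
    rw [← mul_assoc, hHX, smul_mul_assoc, mul_assoc]
  have e7 : ∀ t, H' * (Z * t) = p • (Z * (H' * t)) := fun t => by
    rw [← mul_assoc, hHZ', smul_mul_assoc, mul_assoc]
  have e8 : ∀ t, H' * (X * t) = r⁻¹ • (X * (H' * t)) := fun t => by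
    rw [← mul_assoc, hHX', smul_mul_assoc, mul_assoc]
  simp only [mul_sub, sub_mul, mul_add, smul_mul_assoc, mul_smul_comm, mul_assoc, smul_sub, smul_add,
    hXZ, hXW, hYZ, hYW, hHZ, hHX, hHZ', hHX', e1, e2, e3, e4, e5, e6, e7, e8]
  match_scalars <;> field_simp <;> ring

/-- Abstract inductive step for the commutator of opposite root vectors. -/
theorem aux_step {F A : Type} [Field F] [Ring A] [Algebra F A] (W w Y y M M' L L' : A)
    (p s t k : F) (hp : p ≠ 0) (hd : p - p⁻¹ ≠ 0)
    (hWy : W * y = y * W) (hwY : w * Y = Y * w)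
    (hWY : W * Y = s • (Y * W) + k • (M - M'))
    (hwy : w * y = t • (y * w) + (p - p⁻¹)⁻¹ • (L - L'))
    (hLW : L * W = p⁻¹ • (W * L)) (hLW' : L' * W = p • (W * L'))
    (hLY : L * Y = p • (Y * L)) (hLY' : L' * Y = p⁻¹ • (Y * L'))
    (hMw : M * w = p⁻¹ • (w * M)) (hMw' : M' * w = p • (w * M'))
    (hMy : M * y = p • (y * M)) (hMy' : M' * y = p⁻¹ • (y * M'))
    (h1 : L * M = M * L) (h2 : L * M' = M' * L) (h3 : L' * M = M * L') (h4 : L' * M' = M' * L') :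
    (W * w - p⁻¹ • (w * W)) * (y * Y - p • (Y * y))
      - (s * t) • ((y * Y - p • (Y * y)) * (W * w - p⁻¹ • (w * W)))
      = k • (M * L - M' * L') := by
  have hWL : W * L = p • (L * W) := by rw [hLW, smul_smul, mul_inv_cancel₀ hp, one_smul]
  have hWL' : W * L' = p⁻¹ • (L' * W) := by rw [hLW', smul_smul, inv_mul_cancel₀ hp, one_smul]
  have c1 : W * (w * (y * Y)) = (s * t) • (y * (Y * (W * w)))
      + (t * k) • (y * (M * w) - y * (M' * w)) 
      + (p - p⁻¹)⁻¹ • (p • (L * (W * Y)) - p⁻¹ • (L' * (W * Y))) := by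
    rw [← mul_assoc w, hwy]
    simp only [add_mul, sub_mul, smul_mul_assoc, mul_add, mul_sub, mul_smul_comm, mul_assoc, hwY]
    rw [← mul_assoc W y, hWy, ← mul_assoc W L, hWL, ← mul_assoc W L', hWL', mul_assoc y,
      ← mul_assoc W Y w, hWY]
    simp only [add_mul, sub_mul, smul_mul_assoc, mul_add, mul_sub, mul_smul_comm, mul_assoc, hWY]
    module
  have c2 : W * (w * (Y * y)) = (W * Y) * (w * y) := by
    rw [← mul_assoc w, hwY]; simp only [mul_assoc]
  have c3 : w * (W * (y * Y)) = (w * y) * (W * Y) := by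
    rw [← mul_assoc W, hWy]; simp only [mul_assoc]
  have c4 : w * (W * (Y * y)) = (s * t) • (Y * (y * (w * W)))
      + (s * (p - p⁻¹)⁻¹) • (Y * (L * W) - Y * (L' * W))
      + k • (p • (M * (w * y)) - p⁻¹ • (M' * (w * y))) := by
    have hwM : w * M = p • (M * w) := by rw [hMw, smul_smul, mul_inv_cancel₀ hp, one_smul]
    have hwM' : w * M' = p⁻¹ • (M' * w) := by rw [hMw', smul_smul, inv_mul_cancel₀ hp, one_smul]
    rw [← mul_assoc W, hWY]
    simp only [add_mul, sub_mul, smul_mul_assoc, mul_add, mul_sub, mul_smul_comm, mul_assoc, hWy]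
    rw [← mul_assoc w Y, hwY, ← mul_assoc w M, hwM, ← mul_assoc w M', hwM', mul_assoc Y,
      ← mul_assoc w y W, hwy]
    simp only [add_mul, sub_mul, smul_mul_assoc, mul_add, mul_sub, mul_smul_comm, mul_assoc, hwy]
    module
  have expand : (W * w - p⁻¹ • (w * W)) * (y * Y - p • (Y * y))
      = W * (w * (y * Y)) - p • (W * (w * (Y * y))) - p⁻¹ • (w * (W * (y * Y)))
        + w * (W * (Y * y)) := by
    simp only [mul_sub, sub_mul, smul_mul_assoc, mul_smul_comm, mul_assoc, smul_sub]
    match_scalars <;> field_simp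
  rw [expand, c1, c2, c3, c4, hWY, hwy]
  have f1 : ∀ u, L * (Y * u) = p • (Y * (L * u)) := fun u => by
    rw [← mul_assoc, hLY, smul_mul_assoc, mul_assoc]
  have f2 : ∀ u, L' * (Y * u) = p⁻¹ • (Y * (L' * u)) := fun u => by
    rw [← mul_assoc, hLY', smul_mul_assoc, mul_assoc]
  have f3 : ∀ u, M * (y * u) = p • (y * (M * u)) := fun u => by
    rw [← mul_assoc, hMy, smul_mul_assoc, mul_assoc]
  have f4 : ∀ u, M' * (y * u) = p⁻¹ • (y * (M' * u)) := fun u => by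
    rw [← mul_assoc, hMy', smul_mul_assoc, mul_assoc]
  have f5 : ∀ u, W * (y * u) = y * (W * u) := fun u => by rw [← mul_assoc, hWy, mul_assoc]
  have f6 : ∀ u, w * (Y * u) = Y * (w * u) := fun u => by rw [← mul_assoc, hwY, mul_assoc]
  simp only [mul_sub, sub_mul, mul_add, add_mul, smul_mul_assoc, mul_smul_comm, mul_assoc, smul_sub,
    smul_add, hWy, hwY, f1, f2, f3, f4, f5, f6, hLW, hLW', hMw, hMw', h1, h2, h3, h4]
  have hd' : p ^ 2 - 1 ≠ 0 := by
    intro h; apply hd; field_simp; simpa using h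
  match_scalars <;> field_simp <;> ring

theorem qq_ne : qq ≠ 0 := RatFunc.X_ne_zero

theorem qi_ne (m a : ℕ) : qi m a ≠ 0 := by
  unfold qi; split_ifs
  · exact qq_ne
  · exact inv_ne_zero qq_ne

theorem Δi_eq (m a : ℕ) : Δi m a = qi m a - (qi m a)⁻¹ := by
  unfold Δi qi gr Δq; split_ifs <;> simp

theorem Δq_ne : Δq ≠ 0 := by
  unfold Δq
  intro h
  have h1 : qq * qq = 1 := by
    have := qq_ne
    rw [sub_eq_zero] at h
    nth_rewrite 2 [h]
    exact mul_inv_cancel₀ this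
  have h2 : (Polynomial.X * Polynomial.X : Polynomial ℚ) = 1 := by
    apply RatFunc.algebraMap_injective ℚ
    simpa [qq] using h1
  have := congrArg (Polynomial.eval 2) h2
  norm_num at this

theorem Δi_ne (m a : ℕ) : Δi m a ≠ 0 := by
  unfold Δi
  exact mul_ne_zero (pow_ne_zero _ (by norm_num)) Δq_ne

namespace UqGl

theorem raise_def {m n : ℕ} (U : UqGl m n) {a c b : ℕ} (ha : 1 ≤ a) (hac : a < c) (hcb : c < b)
    (hb : b ≤ m + n) :
    U.E a b = U.E a c * U.E c b - (qi m c)⁻¹ • (U.E c b * U.E a c) := by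
  have := U.nonsimple_def a b c ha (by omega) (by omega) hb (Or.inl ⟨hac, hcb⟩)
  rwa [if_neg (by omega)] at this

theorem lower_def {m n : ℕ} (U : UqGl m n) {a c b : ℕ} (ha : 1 ≤ a) (hac : a < c) (hcb : c < b)
    (hb : b ≤ m + n) :
    U.E b a = U.E b c * U.E c a - qi m c • (U.E c a * U.E b c) := by
  have := U.nonsimple_def b a c (by omega) hb ha (by omega) (Or.inr ⟨hac, hcb⟩)
  rwa [if_pos (by omega)] at this

/-- `g` has weight `w` on `x`. -/
theorem wt_comb {m n : ℕ} (U : UqGl m n) {g x y : U.A} {w v : Fq} (k : Fq)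
    (hx : g * x = w • (x * g)) (hy : g * y = v • (y * g)) :
    g * (x * y - k • (y * x)) = (w * v) • ((x * y - k • (y * x)) * g) := by
  have e1 : g * (x * y) = (w * v) • (x * y * g) := by
    rw [← mul_assoc, hx, smul_mul_assoc, mul_assoc, hy, mul_smul_comm, smul_smul, mul_assoc]
  have e2 : g * (y * x) = (w * v) • (y * x * g) := by
    rw [← mul_assoc, hy, smul_mul_assoc, mul_assoc, hx, mul_smul_comm, smul_smul, mul_assoc,
      mul_comm v]
  rw [mul_sub, mul_smul_comm, e1, e2, sub_mul, smul_mul_assoc, smul_sub, smul_comm k]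

theorem K_raise {m n : ℕ} (U : UqGl m n) (x a l : ℕ) (hx : 1 ≤ x) (hx' : x ≤ m + n)
    (ha : 1 ≤ a) (hb : a + l + 1 ≤ m + n) :
    U.K x * U.E a (a + l + 1)
      = (qi m x ^ (δℤ x a - δℤ x (a + l + 1))) • (U.E a (a + l + 1) * U.K x) := by
  induction l with
  | zero => exact U.K_E_raise x a hx hx' ha hb
  | succ l ih =>
    rw [show a + (l + 1) + 1 = a + l + 1 + 1 from by omega] at *
    have h := U.wt_comb (qi m (a + l + 1))⁻¹ (ih (by omega))
      (U.K_E_raise x (a + l + 1) hx hx' (by omega) hb)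
    rw [← zpow_add₀ (qi_ne m x), ← U.raise_def ha (show a < a + l + 1 by omega) (by omega) hb] at h
    rw [h]
    congr 2; ring

theorem K_lower {m n : ℕ} (U : UqGl m n) (x a l : ℕ) (hx : 1 ≤ x) (hx' : x ≤ m + n)
    (ha : 1 ≤ a) (hb : a + l + 1 ≤ m + n) :
    U.K x * U.E (a + l + 1) a
      = (qi m x ^ (δℤ x (a + l + 1) - δℤ x a)) • (U.E (a + l + 1) a * U.K x) := by
  induction l with
  | zero => exact U.K_E_lower x a hx hx' ha hb
  | succ l ih =>
    rw [show a + (l + 1) + 1 = a + l + 1 + 1 from by omega] at *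
    have h := U.wt_comb (qi m (a + l + 1))
      (U.K_E_lower x (a + l + 1) hx hx' (by omega) hb) (ih (by omega))
    rw [← zpow_add₀ (qi_ne m x), ← U.lower_def ha (show a < a + l + 1 by omega) (by omega) hb] at h
    rw [h]
    congr 2; ring

theorem K_E {m n : ℕ} (U : UqGl m n) (x a b : ℕ) (hx : 1 ≤ x) (hx' : x ≤ m + n)
    (ha : 1 ≤ a) (ha' : a ≤ m + n) (hb : 1 ≤ b) (hb' : b ≤ m + n) (hab : a ≠ b) :
    U.K x * U.E a b = (qi m x ^ (δℤ x a - δℤ x b)) • (U.E a b * U.K x) := by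
  rcases lt_or_gt_of_ne hab with h | h
  · obtain ⟨l, rfl⟩ := Nat.exists_eq_add_of_lt h
    exact U.K_raise x a l hx hx' ha hb'
  · obtain ⟨l, rfl⟩ := Nat.exists_eq_add_of_lt h
    exact U.K_lower x b l hx hx' hb ha'

theorem Kinv_E {m n : ℕ} (U : UqGl m n) (x a b : ℕ) (hx : 1 ≤ x) (hx' : x ≤ m + n)
    (ha : 1 ≤ a) (ha' : a ≤ m + n) (hb : 1 ≤ b) (hb' : b ≤ m + n) (hab : a ≠ b) :
    U.Kinv x * U.E a b = (qi m x ^ (δℤ x b - δℤ x a)) • (U.E a b * U.Kinv x) := by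
  have h := U.K_E x a b hx hx' ha ha' hb hb' hab
  have h2 : U.E a b * U.K x = (qi m x ^ (δℤ x b - δℤ x a)) • (U.K x * U.E a b) := by
    rw [h, smul_smul, ← zpow_add₀ (qi_ne m x)]; simp
  calc U.Kinv x * U.E a b = U.Kinv x * (U.E a b * U.K x) * U.Kinv x := by
        rw [mul_assoc, mul_assoc, U.K_Kinv x hx hx', mul_one]
    _ = _ := by
        rw [h2, mul_smul_comm, smul_mul_assoc, ← mul_assoc, U.Kinv_K x hx hx', one_mul]

/-- Weights of `K_x K_y⁻¹`. -/
theorem KK_E {m n : ℕ} (U : UqGl m n) (x y a b : ℕ) (hx : 1 ≤ x) (hx' : x ≤ m + n)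
    (hy : 1 ≤ y) (hy' : y ≤ m + n)
    (ha : 1 ≤ a) (ha' : a ≤ m + n) (hb : 1 ≤ b) (hb' : b ≤ m + n) (hab : a ≠ b) :
    (U.K x * U.Kinv y) * U.E a b = (qi m x ^ (δℤ x a - δℤ x b) * qi m y ^ (δℤ y b - δℤ y a))
      • (U.E a b * (U.K x * U.Kinv y)) := by
  rw [mul_assoc, U.Kinv_E y a b hy hy' ha ha' hb hb' hab, mul_smul_comm, ← mul_assoc,
    U.K_E x a b hx hx' ha ha' hb hb' hab, smul_mul_assoc, smul_smul, mul_assoc, mul_comm]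

theorem cKK {m n : ℕ} (U : UqGl m n) (x y : ℕ) (hx : 1 ≤ x) (hx' : x ≤ m + n)
    (hy : 1 ≤ y) (hy' : y ≤ m + n) : Commute (U.K x) (U.K y) := U.K_comm x y hx hx' hy hy'

theorem cKK' {m n : ℕ} (U : UqGl m n) (x y : ℕ) (hx : 1 ≤ x) (hx' : x ≤ m + n)
    (hy : 1 ≤ y) (hy' : y ≤ m + n) : Commute (U.K x) (U.Kinv y) := by
  have h := U.K_comm x y hx hx' hy hy'
  calc U.K x * U.Kinv y = U.Kinv y * (U.K y * U.K x) * U.Kinv y := by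
        rw [← mul_assoc, U.Kinv_K y hy hy', one_mul]
    _ = U.Kinv y * U.K x := by
        rw [← h, mul_assoc, mul_assoc, U.K_Kinv y hy hy', mul_one]

theorem cK'K' {m n : ℕ} (U : UqGl m n) (x y : ℕ) (hx : 1 ≤ x) (hx' : x ≤ m + n)
    (hy : 1 ≤ y) (hy' : y ≤ m + n) : Commute (U.Kinv x) (U.Kinv y) := by
  have h : U.K x * U.Kinv y = U.Kinv y * U.K x := U.cKK' x y hx hx' hy hy'
  calc U.Kinv x * U.Kinv y = U.Kinv x * (U.Kinv y * U.K x) * U.Kinv x := by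
        rw [mul_assoc, mul_assoc, U.K_Kinv x hx hx', mul_one]
    _ = U.Kinv y * U.Kinv x := by
        rw [← h, ← mul_assoc, U.Kinv_K x hx hx', one_mul]

theorem cHH {m n : ℕ} (U : UqGl m n) (x y z w : ℕ) (hx : 1 ≤ x) (hx' : x ≤ m + n)
    (hy : 1 ≤ y) (hy' : y ≤ m + n) (hz : 1 ≤ z) (hz' : z ≤ m + n) (hw : 1 ≤ w) (hw' : w ≤ m + n) :
    Commute (U.K x * U.Kinv y) (U.K z * U.Kinv w) :=
  ((U.cKK x z hx hx' hz hz').mul_right (U.cKK' x w hx hx' hw hw')).mul_left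
    (((U.cKK' z y hz hz' hy hy').symm).mul_right (U.cK'K' y w hy hy' hw hw'))

theorem comm_simple {m n : ℕ} (U : UqGl m n) (i j : ℕ) (hi : 1 ≤ i) (hi' : i + 1 ≤ m + n)
    (hj : 1 ≤ j) (hj' : j + 1 ≤ m + n) (hij : i ≠ j) :
    Commute (U.E i (i + 1)) (U.E (j + 1) j) := by
  have h := U.EF_rel i j hi hi' hj hj'
  have hs : sgn m i (i + 1) (j + 1) j = 1 := by
    unfold sgn gr; split_ifs <;> first | omega | norm_num
  rw [if_neg hij, zero_smul, hs, one_smul, sub_eq_zero] at h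
  exact h

theorem comm_half {m n : ℕ} (U : UqGl m n) (a l j : ℕ) (ha : 1 ≤ a) (hb : a + l + 1 ≤ m + n)
    (hj : 1 ≤ j) (hj' : j + 1 ≤ m + n) (h : a + l + 1 ≤ j ∨ j + 1 ≤ a) :
    Commute (U.E a (a + l + 1)) (U.E (j + 1) j) := by
  induction l with
  | zero => exact U.comm_simple a j ha hb hj hj' (by omega)
  | succ l ih =>
    rw [show a + (l + 1) + 1 = a + l + 1 + 1 from by omega] at *
    have i1 := ih (by omega) (by omega)
    have i2 := U.comm_simple (a + l + 1) j (by omega) hb hj hj' (by omega)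
    rw [U.raise_def ha (show a < a + l + 1 by omega) (by omega) hb]
    exact (i1.mul_left i2).sub_left ((i2.mul_left i1).smul_left _)

theorem comm_full {m n : ℕ} (U : UqGl m n) (a l c k : ℕ) (ha : 1 ≤ a) (hb : a + l + 1 ≤ m + n)
    (hc : 1 ≤ c) (hd : c + k + 1 ≤ m + n) (h : a + l + 1 ≤ c ∨ c + k + 1 ≤ a) :
    Commute (U.E a (a + l + 1)) (U.E (c + k + 1) c) := by
  induction k with
  | zero => exact U.comm_half a l c ha hb hc hd h
  | succ k ih =>
    rw [show c + (k + 1) + 1 = c + k + 1 + 1 from by omega] at *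
    have i1 := ih (by omega) (by omega)
    have i2 := U.comm_half a l (c + k + 1) ha hb (by omega) hd (by omega)
    rw [U.lower_def hc (show c < c + k + 1 by omega) (by omega) hd]
    exact (i2.mul_right i1).sub_right ((i1.mul_right i2).smul_right _)

/-- Raising `E^a_b` commutes with lowering `E^d_c` when the intervals are disjoint. -/
theorem comm_disj {m n : ℕ} (U : UqGl m n) (a b c d : ℕ) (ha : 1 ≤ a) (hab : a < b)
    (hb : b ≤ m + n) (hc : 1 ≤ c) (hcd : c < d) (hd : d ≤ m + n) (h : b ≤ c ∨ d ≤ a) :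
    Commute (U.E a b) (U.E d c) := by
  obtain ⟨l, rfl⟩ := Nat.exists_eq_add_of_lt hab
  obtain ⟨k, rfl⟩ := Nat.exists_eq_add_of_lt hcd
  exact U.comm_full a l c k ha hb hc hd h

theorem EF_gen {m n : ℕ} (U : UqGl m n) (a l : ℕ) (ha : 1 ≤ a) (hb : a + l + 1 ≤ m + n) :
    U.E a (a + l + 1) * U.E (a + l + 1) a
      - sgn m a (a + l + 1) (a + l + 1) a • (U.E (a + l + 1) a * U.E a (a + l + 1))
      = (Δi m a)⁻¹ • (U.K a * U.Kinv (a + l + 1) - U.K (a + l + 1) * U.Kinv a) := by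
  induction l with
  | zero =>
    have h := U.EF_rel a a ha hb ha hb
    rw [if_pos rfl, (U.cKK' (a+1) a (by omega) hb ha (by omega)).symm.eq] at h
    exact h
  | succ l ih =>
    rw [show a + (l + 1) + 1 = a + l + 1 + 1 from by omega] at *
    have ih := ih (by omega)
    have h0 := U.EF_rel (a+l+1) (a+l+1) (by omega) hb (by omega) hb
    rw [if_pos rfl, (U.cKK' (a+l+1+1) (a+l+1) (by omega) hb (by omega) (by omega)).symm.eq] at h0
    generalize he : a + l + 1 = e at *
    have hae : a < e := by omega
    have n1 : a ≠ e := by omega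
    have n2 : e ≠ a := by omega
    have n3 : a ≠ e + 1 := by omega
    have n4 : e + 1 ≠ a := by omega
    have hsgn : sgn m a (e + 1) (e + 1) a = sgn m a e e a * sgn m e (e+1) (e+1) e := by
      unfold sgn gr; split_ifs <;> first | omega | norm_num
    rw [sub_eq_iff_eq_add'] at ih h0
    rw [Δi_eq m e] at h0
    have key := aux_step (U.E a e) (U.E e (e+1)) (U.E e a) (U.E (e+1) e)
      (U.K a * U.Kinv e) (U.K e * U.Kinv a) (U.K e * U.Kinv (e+1)) (U.K (e+1) * U.Kinv e)
      (qi m e) _ _ _ (qi_ne m e) (Δi_eq m e ▸ Δi_ne m e)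
      (U.comm_disj a e e (e+1) ha hae (by omega) (by omega) (by omega) hb (by omega))
      (U.comm_disj e (e+1) a e (by omega) (by omega) hb ha hae (by omega) (by omega))
      ih h0
      (by rw [KK_E]
          · congr 1; simp [δℤ, n1, n2, n3, n4]
          all_goals omega)
      (by rw [KK_E]
          · congr 1; simp [δℤ, n1, n2, n3, n4]
          all_goals omega)
      (by rw [KK_E]
          · congr 1; simp [δℤ, n1, n2, n3, n4]
          all_goals omega)
      (by rw [KK_E]
          · congr 1; simp [δℤ, n1, n2, n3, n4]
          all_goals omega)
      (by rw [KK_E]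
          · congr 1; simp [δℤ, n1, n2, n3, n4]
          all_goals omega)
      (by rw [KK_E]
          · congr 1; simp [δℤ, n1, n2, n3, n4]
          all_goals omega)
      (by rw [KK_E]
          · congr 1; simp [δℤ, n1, n2, n3, n4]
          all_goals omega)
      (by rw [KK_E]
          · congr 1; simp [δℤ, n1, n2, n3, n4]
          all_goals omega)
      (by apply cHH <;> omega) (by apply cHH <;> omega)
      (by apply cHH <;> omega) (by apply cHH <;> omega)
    rw [← U.raise_def ha hae (by omega) hb, ← U.lower_def ha hae (by omega) hb, ← hsgn] at key
    rw [key]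
    congr 2
    · rw [mul_assoc, ← mul_assoc (U.Kinv e), U.Kinv_K e (by omega) (by omega), one_mul]
    · rw [(U.cHH e a (e+1) e (by omega) (by omega) (by omega) (by omega) (by omega) (by omega)
        (by omega) (by omega)).eq, mul_assoc, ← mul_assoc (U.Kinv e),
        U.Kinv_K e (by omega) (by omega), one_mul]

end UqGl

theorem stmt18 (m n : ℕ) (hm : 1 ≤ m) (hn : 1 ≤ n) (U : UqGl m n)
    (a b c d : ℕ)
    (h1 : 1 ≤ a) (h2 : a ≤ m + n) (h3 : 1 ≤ b) (h4 : b ≤ m + n)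
    (h5 : 1 ≤ c) (h6 : c ≤ m + n) (h7 : 1 ≤ d) (h8 : d ≤ m + n)
    (hca : c < a) (had : a < d) (hdb : d < b) :
    U.br b a c d = Δi m a • (U.Kinv d * U.K a * U.E c a * U.E b d) := by
  obtain ⟨l, rfl⟩ := Nat.exists_eq_add_of_lt had
  have hEF := U.EF_gen a l h1 h8
  generalize a + l + 1 = d at *
  have hs2 : sgn m b a c d = sgn m a d d a := by
    unfold sgn gr; split_ifs <;> first | omega | norm_num
  have hss : sgn m a d d a * sgn m a d d a = 1 := by
    unfold sgn gr; split_ifs <;> norm_num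
  have hsD : sgn m a d d a * Δi m d = Δi m a := by
    unfold sgn Δi gr; split_ifs <;> first | omega | norm_num
  rw [hs2.symm] at hEF hss hsD
  have hYW : U.E d a * U.E a d = sgn m b a c d • (U.E a d * U.E d a)
      + (-(sgn m b a c d * (Δi m a)⁻¹)) • (U.K a * U.Kinv d - U.K d * U.Kinv a) := by
    rw [neg_smul, mul_smul, ← hEF, smul_sub, smul_smul, hss, one_smul]; abel
  have key := aux_main (U.E b d) (U.E d a) (U.E c a) (U.E a d)
    (U.K a * U.Kinv d) (U.K d * U.Kinv a) (qi m a) (qi m d) _ _ (qi_ne m a) (qi_ne m d)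
    (U.comm_disj c a d b (by omega) (by omega) (by omega) (by omega) (by omega) h4 (by omega)).symm
    (U.comm_disj a d d b (by omega) (by omega) (by omega) (by omega) (by omega) h4 (by omega)).symm
    (U.comm_disj c a a d (by omega) (by omega) (by omega) (by omega) (by omega) h8 (by omega)).symm
    hYW
    (by rw [UqGl.KK_E]
        · congr 1; simp [δℤ, hca.ne', had.ne, had.ne', hdb.ne, (hca.trans had).ne', (had.trans hdb).ne]
        all_goals omega)
    (by rw [UqGl.KK_E]
        · congr 1; simp [δℤ, hca.ne', had.ne, had.ne', hdb.ne, (hca.trans had).ne', (had.trans hdb).ne]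
        all_goals omega)
    (by rw [UqGl.KK_E]
        · congr 1; simp [δℤ, hca.ne', had.ne, had.ne', hdb.ne, (hca.trans had).ne', (had.trans hdb).ne]
        all_goals omega)
    (by rw [UqGl.KK_E]
        · congr 1; simp [δℤ, hca.ne', had.ne, had.ne', hdb.ne, (hca.trans had).ne', (had.trans hdb).ne]
        all_goals omega)
  rw [← U.raise_def h5 hca had h8, ← U.lower_def h1 had hdb h4, ← Δi_eq, ← Δi_eq] at key
  unfold UqGl.br
  rw [key, (U.cKK' a d h1 h2 h7 h8).eq]
  congr 1
  rw [neg_neg, mul_assoc, mul_assoc, inv_mul_cancel_left₀ (Δi_ne m a), hsD]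

end
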